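/- For every multi-index ν and every unit multi-index e (i.e. |e| = 1), the sum over all multi-indices η with 0 < η ≤ ν of (ν choose η) · [1/2]_{|η|} · [1/2]_{|ν+e−η|} is at most [1/2]_{|ν+e|}. -/

import Mathlib

/-- The absolute falling factorial `[1/2]_n`: `[1/2]_0 = 1`, and
`[1/2]_{n+1} = |n - 1/2| * [1/2]_n`, so that `[1/2]_1 = 1/2`. -/
noncomputable def gd : ℕ → ℝ
  | 0 => 1
  | n + 1 => |(n : ℝ) - 1 / 2| * gd n

/-- The total degree `|ν| = Σ_j ν_j` of a multi-index. -/
def deg (ν : ℕ →₀ ℕ) : ℕ := ν.sum fun _ n => n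

/-- The multi-index binomial coefficient `(ν choose η) = Π_j (ν_j choose η_j)`. -/
def mchoose (ν η : ℕ →₀ ℕ) : ℕ := ∏ j ∈ ν.support ∪ η.support, (ν j).choose (η j)

theorem gd_aux (k : ℕ) : gd (k + 1) = ((k + 1).factorial : ℝ) * (catalan k : ℝ) / (2 * 4 ^ k) := by
  induction k with
  | zero => norm_num [gd, abs_of_nonneg]
  | succ k ih =>
    rw [gd, ih]
    have h1 := succ_mul_catalan_eq_centralBinom k
    have h2 := succ_mul_catalan_eq_centralBinom (k + 1)
    have h3 := Nat.succ_mul_centralBinom_succ k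
    rw [← h1, ← h2] at h3
    have h4 : ((k : ℝ) + 1) * (((k : ℝ) + 1 + 1) * (catalan (k + 1) : ℝ))
        = 2 * (2 * (k : ℝ) + 1) * (((k : ℝ) + 1) * (catalan k : ℝ)) := by exact_mod_cast h3
    have hk : ((k : ℝ) + 1) ≠ 0 := by positivity
    have h5 : ((k : ℝ) + 1 + 1) * (catalan (k + 1) : ℝ) = 2 * (2 * (k : ℝ) + 1) * (catalan k : ℝ) := by
      apply mul_left_cancel₀ hk
      linear_combination h4
    rw [abs_of_nonneg (by push_cast; have : (0 : ℝ) ≤ k := by positivity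
                          linarith), Nat.factorial_succ (k + 1), pow_succ]
    push_cast
    field_simp
    linear_combination -2 * h5

theorem gd_nonneg (n : ℕ) : 0 ≤ gd n := by
  induction n with
  | zero => simp [gd]
  | succ n ih => rw [gd]; positivity

/-- One-dimensional identity. -/
theorem gd_conv (m : ℕ) :
    ∑ p ∈ Finset.HasAntidiagonal.antidiagonal m, ((m + 1).choose (p.1 + 1) : ℝ) * gd (p.1 + 1) * gd (p.2 + 1)
      = gd (m + 2) := by
  have key : ∀ p ∈ Finset.HasAntidiagonal.antidiagonal m,
      ((m + 1).choose (p.1 + 1) : ℝ) * gd (p.1 + 1) * gd (p.2 + 1)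
       = ((m + 1).factorial : ℝ) / (4 * 4 ^ m) * (((p.2 : ℝ) + 1) * (catalan p.1 * catalan p.2)) := by
    rintro ⟨i, j⟩ h
    rw [Finset.HasAntidiagonal.mem_antidiagonal] at h
    simp only at h ⊢
    subst h
    have hc := Nat.add_choose_mul_factorial_mul_factorial (i + 1) j
    rw [show i + 1 + j = i + j + 1 by ring,
      Nat.choose_symm_of_eq_add (show i + j + 1 = j + (i + 1) by ring)] at hc
    rw [← hc, gd_aux, gd_aux, Nat.factorial_succ j, pow_add]
    push_cast
    field_simp
    norm_num
    ring
  rw [Finset.sum_congr rfl key, ← Finset.mul_sum]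
  have hs : ∑ p ∈ Finset.HasAntidiagonal.antidiagonal m, ((p.2 : ℝ) + 1) * ((catalan p.1 : ℝ) * catalan p.2)
      = ∑ p ∈ Finset.HasAntidiagonal.antidiagonal m, ((p.1 : ℝ) + 1) * ((catalan p.1 : ℝ) * catalan p.2) := by
    rw [← Finset.Nat.sum_antidiagonal_swap]
    refine Finset.sum_congr rfl fun p _ => ?_
    simp only [Prod.fst_swap, Prod.snd_swap]
    ring
  have ht : ∑ p ∈ Finset.HasAntidiagonal.antidiagonal m, ((p.2 : ℝ) + 1) * ((catalan p.1 : ℝ) * catalan p.2)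
      + ∑ p ∈ Finset.HasAntidiagonal.antidiagonal m, ((p.1 : ℝ) + 1) * ((catalan p.1 : ℝ) * catalan p.2)
      = ((m : ℝ) + 2) * catalan (m + 1) := by
    rw [← Finset.sum_add_distrib, catalan_succ', Nat.cast_sum, Finset.mul_sum]
    refine Finset.sum_congr rfl fun p hp => ?_
    rw [Finset.HasAntidiagonal.mem_antidiagonal] at hp
    rw [← hp]
    push_cast
    ring
  rw [← hs] at ht
  generalize ∑ p ∈ Finset.HasAntidiagonal.antidiagonal m, ((p.2 : ℝ) + 1) * ((catalan p.1 : ℝ) * catalan p.2) = S at ht ⊢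
  rw [show m + 2 = (m + 1) + 1 by ring, gd_aux, Nat.factorial_succ (m + 1), pow_succ]
  push_cast
  field_simp
  linear_combination ht

theorem deg_eq (ν : ℕ →₀ ℕ) (s : Finset ℕ) (h : ν.support ⊆ s) : deg ν = ∑ j ∈ s, ν j :=
  Finsupp.sum_of_support_subset _ h _ (by simp)

theorem deg_add (a b : ℕ →₀ ℕ) : deg (a + b) = deg a + deg b :=
  Finsupp.sum_add_index' (by simp) (by simp)

open Polynomial in
theorem poly_id (ν : ℕ →₀ ℕ) :
    ∑ η ∈ Finset.Icc 0 ν, (mchoose ν η : ℝ[X]) * X ^ deg η = (X + 1) ^ deg ν := by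
  classical
  have hI : Finset.Icc 0 ν = ν.support.finsupp (fun j => Finset.range (ν j + 1)) := by
    ext η
    rw [Finset.mem_finsupp_iff, Finset.mem_Icc]
    constructor
    · rintro ⟨-, h⟩
      exact ⟨Finsupp.support_mono h, fun i _ => by simpa [Nat.lt_succ_iff] using h i⟩
    · rintro ⟨h1, h2⟩
      refine ⟨zero_le, fun i => ?_⟩
      by_cases hi : i ∈ ν.support
      · simpa [Nat.lt_succ_iff] using h2 i hi
      · have : η i = 0 := by
          by_contra hc
          exact hi (h1 (by simpa using hc))
        omega
  rw [hI, Finset.finsupp, Finset.sum_map, deg_eq ν _ subset_rfl, ← Finset.prod_pow_eq_pow_sum]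
  have hb : ∀ j ∈ ν.support, ((X : ℝ[X]) + 1) ^ ν j
      = ∑ i ∈ Finset.range (ν j + 1), ((ν j).choose i : ℝ[X]) * X ^ i := by
    intro j _
    rw [add_pow]
    refine Finset.sum_congr rfl fun i _ => ?_
    rw [one_pow]; ring
  rw [Finset.prod_congr rfl hb, Finset.prod_sum]
  refine Finset.sum_congr (by congr!) fun p hp => ?_
  simp only [Function.Embedding.coeFn_mk]
  have hsup := Finsupp.support_indicator_subset ν.support p
  rw [deg_eq _ _ hsup, mchoose, Finset.union_eq_left.2 hsup, Nat.cast_prod,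
    ← Finset.prod_pow_eq_pow_sum, ← Finset.prod_mul_distrib, ← Finset.prod_attach]
  refine Finset.prod_congr rfl fun x _ => ?_
  rw [Finsupp.indicator_of_mem x.2]

open Polynomial in
theorem vander (ν : ℕ →₀ ℕ) (f : ℕ → ℝ) :
    ∑ η ∈ Finset.Icc 0 ν, (mchoose ν η : ℝ) * f (deg η)
      = ∑ k ∈ Finset.range (deg ν + 1), ((deg ν).choose k : ℝ) * f k := by
  let L : ℝ[X] →ₗ[ℝ] ℝ := Polynomial.lsum (fun k => f k • LinearMap.id)
  have hL : ∀ (c k : ℕ), L ((c : ℝ[X]) * X ^ k) = (c : ℝ) * f k := by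
    intro c k
    have : (c : ℝ[X]) * X ^ k = monomial k (c : ℝ) := by
      rw [← C_mul_X_pow_eq_monomial]; simp
    rw [this]
    simp [L, Polynomial.lsum_apply, mul_comm]
  have h := congrArg L (poly_id ν)
  rw [add_pow, map_sum, map_sum] at h
  simp only [hL] at h
  rw [h]
  refine Finset.sum_congr rfl fun k _ => ?_
  rw [one_pow, mul_one, mul_comm, hL]

theorem stmt5 (ν e : ℕ →₀ ℕ) (he : deg e = 1) :
    ∑ η ∈ Finset.Ioc 0 ν, (mchoose ν η : ℝ) * gd (deg η) * gd (deg (ν + e - η))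
      ≤ gd (deg (ν + e)) := by
  have h1 : ∀ η ∈ Finset.Icc 0 ν, (mchoose ν η : ℝ) * gd (deg η) * gd (deg (ν + e - η))
      = (mchoose ν η : ℝ) * (gd (deg η) * gd (deg ν + 1 - deg η)) := by
    intro η hη
    have hle : η ≤ ν + e := (Finset.mem_Icc.1 hη).2.trans le_self_add
    have h := deg_add (ν + e - η) η
    rw [tsub_add_cancel_of_le hle, deg_add, he] at h
    rw [show deg (ν + e - η) = deg ν + 1 - deg η by omega, mul_assoc]
  have h2 := vander ν (fun k => gd k * gd (deg ν + 1 - k))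
  rw [← Finset.sum_congr rfl h1, ← Finset.Ioc_insert_left (zero_le : 0 ≤ ν),
    Finset.sum_insert (by simp), Finset.sum_range_succ'] at h2
  have h0 : mchoose ν 0 = 1 := by simp [mchoose]
  have hd0 : deg 0 = 0 := by simp [deg]
  rw [h0, hd0, tsub_zero, deg_add, he] at h2
  rw [deg_add, he]
  simp only [Nat.choose_zero_right, Nat.cast_one, one_mul, tsub_zero] at h2
  have h3 : ∑ η ∈ Finset.Ioc 0 ν, (mchoose ν η : ℝ) * gd (deg η) * gd (deg (ν + e - η))
     = ∑ k ∈ Finset.range (deg ν), ((deg ν).choose (k + 1) : ℝ) *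
        (gd (k + 1) * gd (deg ν + 1 - (k + 1))) := by linarith
  rw [h3]
  generalize deg ν = n
  cases n with
  | zero => simpa using gd_nonneg _
  | succ m =>
    rw [← gd_conv m, Finset.Nat.sum_antidiagonal_eq_sum_range_succ_mk]
    refine le_of_eq (Finset.sum_congr rfl fun k hk => ?_)
    rw [Finset.mem_range] at hk
    rw [show m + 1 + 1 - (k + 1) = m - k + 1 by omega, mul_assoc]
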